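/- arXiv:2512.08775 — 2 statements merged into one kernel-verified Lean document; each statement's English description precedes it below -/
import Mathlib

section
/- Let f : ℝⁿ → ℝ be twice continuously differentiable with L₂-Lipschitz Hessian, and let ρ : ℝⁿ → ℝ be differentiable, σ_V-strongly convex, with L_V-Lipschitz gradient, where 2σ_V > L_V. Fix η > 0, 0 < ξ ≤ (√5 − 1)/2, a point x_k with ∇f(x_k) ≠ 0, and a symmetric matrix H_k. Define r_k = ξ / ( (‖∇²f(x_k) − H_k‖/‖∇f(x_k)‖^{1/2})·(1 + L_V/(2σ_V − L_V)) + √(ξ·(L₂/2 + L_V·(2η + L₂/3)/(2σ_V − L_V))) ) and A_k = ‖∇²f(x_k) − H_k‖/(2σ_V − L_V) + (r_k‖∇f(x_k)‖^{1/2}/(2σ_V − L_V))·(2η + L₂/3). Suppose H_k − (L_V − σ_V)A_k·I is positive semidefinite, and d ∈ ℝⁿ, λ ≥ 0 satisfy H_k d + λd + A_k(∇ρ(x_k + d) − ∇ρ(x_k)) = −∇f(x_k) and ‖d‖ ≤ r_k‖∇f(x_k)‖^{1/2}. Then ‖∇f(x_k + d)‖ ≤ (1 + ξ)‖∇f(x_k)‖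 ≤ (1/ξ)‖∇f(x_k)‖. -/
open RealInnerProductSpace

/-- Taylor bound of first order for a map with Lipschitz derivative. -/
lemma norm_sub_sub_fderiv_le_of_lipschitz_fderiv {E F : Type*} [NormedAddCommGroup E]
    [NormedSpace ℝ E] [NormedAddCommGroup F] [NormedSpace ℝ F] {G : E → F} {L : ℝ}
    (hG : Differentiable ℝ G)
    (hL : ∀ x y, ‖fderiv ℝ G x - fderiv ℝ G y‖ ≤ L * ‖x - y‖) (x d : E) :
    ‖G (x + d) - G x - fderiv ℝ G x d‖ ≤ L / 2 * ‖d‖ ^ 2 := by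
  have hφ : ∀ t : ℝ, HasDerivAt (fun t : ℝ => G (x + t • d) - G x - t • fderiv ℝ G x d)
      (fderiv ℝ G (x + t • d) d - fderiv ℝ G x d) t := by
    intro t
    have h1 : HasDerivAt (fun t : ℝ => x + t • d) d t := by
      simpa using ((hasDerivAt_id t).smul_const d).const_add x
    have h2 := (hG (x + t • d)).hasFDerivAt.comp_hasDerivAt t h1
    have h3 : HasDerivAt (fun t : ℝ => t • fderiv ℝ G x d) (fderiv ℝ G x d) t := by
      simpa using (hasDerivAt_id t).smul_const (fderiv ℝ G x d)
    exact (h2.sub_const (G x)).sub h3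
  have hB : ∀ t : ℝ, HasDerivAt (fun t : ℝ => L / 2 * ‖d‖ ^ 2 * t ^ 2) (L * t * ‖d‖ ^ 2) t := by
    intro t
    have h := (hasDerivAt_pow 2 t).const_mul (L / 2 * ‖d‖ ^ 2)
    refine h.congr_deriv ?_
    push_cast
    ring
  have key := image_norm_le_of_norm_deriv_right_le_deriv_boundary (a := 0) (b := 1)
    (fun t _ => (hφ t).continuousAt.continuousWithinAt) (fun t _ => (hφ t).hasDerivWithinAt)
    (by simp) hB (by
      intro t ht
      rw [← sub_apply]
      calc _ ≤ ‖fderiv ℝ G (x + t • d) - fderiv ℝ G x‖ * ‖d‖ :=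
            ContinuousLinearMap.le_opNorm _ _
        _ ≤ (L * ‖x + t • d - x‖) * ‖d‖ := by gcongr; exact hL _ _
        _ = L * t * ‖d‖ ^ 2 := by
            rw [add_sub_cancel_left, norm_smul, Real.norm_of_nonneg ht.1]; ring)
    (Set.right_mem_Icc.2 zero_le_one)
  simpa using key

/-- The gradient of a `C²` function is differentiable. -/
lemma ContDiff.differentiable_gradient {E : Type*} [NormedAddCommGroup E]
    [InnerProductSpace ℝ E] [CompleteSpace E] {f : E → ℝ} (hf : ContDiff ℝ 2 f) :
    Differentiable ℝ (gradient f) := by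
  have h : Differentiable ℝ (fderiv ℝ f) :=
    (hf.fderiv_right (m := 1) (by norm_num)).differentiable (by norm_num)
  exact (InnerProductSpace.toDual ℝ E).symm.differentiable.comp h

/-- The gradient of a strongly convex function is strongly monotone. -/
lemma inner_gradient_sub_ge_of_strongConvex {E : Type*} [NormedAddCommGroup E]
    [InnerProductSpace ℝ E] [CompleteSpace E] {ρ : E → ℝ} {σ : ℝ}
    (hsc : ∀ x y, ρ y ≥ ρ x + ⟪gradient ρ x, y - x⟫ + σ / 2 * ‖y - x‖ ^ 2) (x d : E) :
    σ * ‖d‖ ^ 2 ≤ ⟪gradient ρ (x + d) - gradient ρ x, d⟫ := by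
  have h1 := hsc x (x + d)
  have h2 := hsc (x + d) x
  rw [add_sub_cancel_left] at h1
  rw [sub_add_cancel_left, inner_neg_right, norm_neg] at h2
  rw [inner_sub_left]
  linarith

/-- The step-size rule `r = ξ / (a + √(ξ K))` satisfies `r a + r² K ≤ ξ`. -/
lemma step_mul_add_sq_le {ξ a K : ℝ} (hξ : 0 < ξ) (ha : 0 ≤ a) (hK : 0 ≤ K) :
    ξ / (a + √(ξ * K)) * a + (ξ / (a + √(ξ * K))) ^ 2 * K ≤ ξ := by
  have hb2 : √(ξ * K) ^ 2 = ξ * K := Real.sq_sqrt (by positivity)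
  have hb : 0 ≤ √(ξ * K) := Real.sqrt_nonneg _
  generalize √(ξ * K) = b at *
  rcases eq_or_lt_of_le (add_nonneg ha hb) with h | h
  · simp [← h, hξ.le]
  · have e : ξ / (a + b) * a + (ξ / (a + b)) ^ 2 * K
        = ξ * (a * (a + b) + b ^ 2) / (a + b) ^ 2 := by
      rw [hb2]; field_simp
    rw [e, div_le_iff₀ (by positivity)]
    gcongr
    nlinarith [mul_nonneg ha hb]

/-- Controlled growth of the gradient norm in the convex analysis of the HAT method:
with the prescribed `r_k`, `A_k`, if `H_k − (L_V − σ_V)A_k·I ⪰ 0` and `ξ ≤ (√5 − 1)/2`,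
then `‖∇f(x_k + d)‖ ≤ (1 + ξ)‖∇f(x_k)‖ ≤ (1/ξ)‖∇f(x_k)‖`. -/
theorem stmt11 {n : ℕ} (f ρ : EuclideanSpace ℝ (Fin n) → ℝ) (L₂ σV LV η ξ : ℝ)
    (hf : ContDiff ℝ 2 f)
    (hfLip : ∀ x y, ‖fderiv ℝ (gradient f) x - fderiv ℝ (gradient f) y‖ ≤ L₂ * ‖x - y‖)
    (hρ : Differentiable ℝ ρ)
    (hsc : ∀ x y, ρ y ≥ ρ x + ⟪gradient ρ x, y - x⟫ + σV / 2 * ‖y - x‖ ^ 2)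
    (hρlip : ∀ x y, ‖gradient ρ y - gradient ρ x‖ ≤ LV * ‖y - x‖)
    (hσL : LV < 2 * σV)
    (hη : 0 < η) (hξ0 : 0 < ξ) (hξ1 : ξ ≤ (Real.sqrt 5 - 1) / 2)
    (xk : EuclideanSpace ℝ (Fin n)) (hxk : gradient f xk ≠ 0)
    (Hk : EuclideanSpace ℝ (Fin n) →L[ℝ] EuclideanSpace ℝ (Fin n))
    (hHsym : ∀ u v, ⟪Hk u, v⟫ = ⟪u, Hk v⟫)
    (rk Ak : ℝ)
    (hrk : rk = ξ / (‖fderiv ℝ (gradient f) xk - Hk‖ / Real.sqrt ‖gradient f xk‖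
          * (1 + LV / (2 * σV - LV))
        + Real.sqrt (ξ * (L₂ / 2 + LV * (2 * η + L₂ / 3) / (2 * σV - LV)))))
    (hAk : Ak = ‖fderiv ℝ (gradient f) xk - Hk‖ / (2 * σV - LV)
        + rk * Real.sqrt ‖gradient f xk‖ / (2 * σV - LV) * (2 * η + L₂ / 3))
    (hHpsd : ∀ v, 0 ≤ ⟪Hk v - ((LV - σV) * Ak) • v, v⟫)
    (d : EuclideanSpace ℝ (Fin n)) (lam : ℝ) (hlam : 0 ≤ lam)
    (hKKT1 : Hk d + lam • d + Ak • (gradient ρ (xk + d) - gradient ρ xk) = -gradient f xk)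
    (hKKT3 : ‖d‖ ≤ rk * Real.sqrt ‖gradient f xk‖) :
    ‖gradient f (xk + d)‖ ≤ (1 + ξ) * ‖gradient f xk‖ ∧
      (1 + ξ) * ‖gradient f xk‖ ≤ 1 / ξ * ‖gradient f xk‖ := by
  have hg : 0 < ‖gradient f xk‖ := norm_pos_iff.2 hxk
  have hL₂ : 0 ≤ L₂ := by
    have h := (norm_nonneg _).trans (hfLip (gradient f xk) 0)
    rw [sub_zero] at h
    exact nonneg_of_mul_nonneg_left h hg
  have hLV : 0 ≤ LV := by
    have h := (norm_nonneg _).trans (hρlip 0 (gradient f xk))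
    rw [sub_zero] at h
    exact nonneg_of_mul_nonneg_left h hg
  have hc : 0 < 2 * σV - LV := by linarith
  have hT := norm_sub_sub_fderiv_le_of_lipschitz_fderiv hf.differentiable_gradient hfLip xk d
  have hm := inner_gradient_sub_ge_of_strongConvex hsc xk d
  have hHd := hHpsd d
  have hlip := hρlip xk (xk + d)
  rw [add_sub_cancel_left] at hlip
  have hop := (fderiv ℝ (gradient f) xk - Hk).le_opNorm d
  rw [sub_apply] at hop
  have hE : 0 ≤ ‖fderiv ℝ (gradient f) xk - Hk‖ := norm_nonneg _
  have hs : 0 < √‖gradient f xk‖ := Real.sqrt_pos.2 hg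
  have hs2 : √‖gradient f xk‖ ^ 2 = ‖gradient f xk‖ := Real.sq_sqrt hg.le
  have hcs := neg_le_of_abs_le (abs_real_inner_le_norm (gradient f xk) d)
  generalize ‖fderiv ℝ (gradient f) xk - Hk‖ = e at *
  generalize √‖gradient f xk‖ = s at *
  have hr : 0 ≤ rk := by rw [hrk]; positivity
  have hA : 0 ≤ Ak := by rw [hAk]; positivity
  have hstep : rk * (e / s) + rk ^ 2 * (L₂ / 2) ≤ ξ := by
    have h := step_mul_add_sq_le (a := e / s * (1 + LV / (2 * σV - LV)))
      (K := L₂ / 2 + LV * (2 * η + L₂ / 3) / (2 * σV - LV)) hξ0 (by positivity) (by positivity)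
    rw [← hrk] at h
    refine le_trans ?_ h
    gcongr
    · exact le_mul_of_one_le_right (by positivity) (le_add_of_nonneg_right (by positivity))
    · exact le_add_of_nonneg_right (by positivity)
  have hmult : (lam + Ak * LV) * ‖d‖ ≤ ‖gradient f xk‖ := by
    rcases eq_or_lt_of_le (norm_nonneg d) with h0 | h0
    · rw [← h0, mul_zero]; exact hg.le
    · have h := congrArg (fun v => ⟪v, d⟫) hKKT1
      simp only [inner_add_left, inner_neg_left, real_inner_smul_left,
        real_inner_self_eq_norm_sq] at h
      rw [inner_sub_left, real_inner_smul_left, real_inner_self_eq_norm_sq] at hHd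
      have hAm := mul_le_mul_of_nonneg_left hm hA
      refine le_of_mul_le_mul_right ?_ h0
      linarith
  have hdecomp : gradient f (xk + d)
      = (gradient f (xk + d) - gradient f xk - fderiv ℝ (gradient f) xk d)
        + (fderiv ℝ (gradient f) xk d - Hk d)
        - (lam • d + Ak • (gradient ρ (xk + d) - gradient ρ xk)) := by
    rw [← neg_eq_iff_eq_neg] at hKKT1
    rw [← sub_eq_zero]
    have h : gradient f xk + (Hk d + lam • d
        + Ak • (gradient ρ (xk + d) - gradient ρ xk)) = 0 := by
      rw [← hKKT1]; abel
    rw [← h]; abel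
  have hrest : ‖lam • d + Ak • (gradient ρ (xk + d) - gradient ρ xk)‖ ≤ ‖gradient f xk‖ := by
    refine (norm_add_le _ _).trans (le_trans ?_ hmult)
    rw [norm_smul, norm_smul, Real.norm_of_nonneg hlam, Real.norm_of_nonneg hA, add_mul, mul_assoc]
    gcongr
  have hd2 : L₂ / 2 * ‖d‖ ^ 2 + e * ‖d‖ ≤ ξ * ‖gradient f xk‖ := by
    calc L₂ / 2 * ‖d‖ ^ 2 + e * ‖d‖ ≤ L₂ / 2 * (rk * s) ^ 2 + e * (rk * s) := by gcongr
      _ = (rk * (e / s) + rk ^ 2 * (L₂ / 2)) * s ^ 2 := by field_simp; ring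
      _ ≤ ξ * ‖gradient f xk‖ := by rw [hs2]; gcongr
  constructor
  · rw [hdecomp]
    refine (norm_sub_le _ _).trans ?_
    have := norm_add_le (gradient f (xk + d) - gradient f xk - fderiv ℝ (gradient f) xk d)
      (fderiv ℝ (gradient f) xk d - Hk d)
    linarith
  · gcongr
    rw [le_div_iff₀ hξ0]
    have h5 : √(5 : ℝ) ^ 2 = 5 := Real.sq_sqrt (by norm_num)
    nlinarith [Real.sqrt_nonneg 5]
end

section
/- Let N ≥ 1, and for i = 1, …, N let φᵢ : ℝⁿ → ℝ be twice continuously differentiable with ‖∇²φᵢ(x)‖ ≤ L for all x ∈ ℝⁿ, and let bᵢ ∈ ℝ. Define f(x) = (1/2)·Σᵢ₌₁ᴺ (φᵢ(x) − bᵢ)² and H(x) = Σᵢ₌₁ᴺ ∇φᵢ(x)∇φᵢ(x)ᵀ. Suppose f has a global minimizer x_* and satisfies the Polyak–Łojasiewicz condition with constant μ > 0: f(x) − f(x_*) ≤ (1/(2μ))‖∇f(x)‖² for all x ∈ ℝⁿ. Then for every x ∈ ℝⁿ, ‖∇²f(x) − H(x)‖ ≤ L·‖∇f(x)‖·√(N/μ)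 + L·√(2N·f(x_*)). -/
open RealInnerProductSpace

section GaussNewton

variable {E : Type*} [NormedAddCommGroup E] [InnerProductSpace ℝ E] [CompleteSpace E]

theorem ContDiff.differentiable_gradient_s15 {g : E → ℝ} (hg : ContDiff ℝ 2 g) :
    Differentiable ℝ (gradient g) :=
  (InnerProductSpace.toDual ℝ E).symm.toContinuousLinearEquiv.differentiable.comp
    ((hg.fderiv_right (m := 1) (by norm_num)).differentiable (by norm_num))

variable {ι : Type*} [Fintype ι] {φ : ι → E → ℝ}

theorem hasGradientAt_half_sum_sq_sub (b : ι → ℝ) {x : E}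
    (hφ : ∀ i, DifferentiableAt ℝ (φ i) x) :
    HasGradientAt (fun y => 1 / 2 * ∑ i, (φ i y - b i) ^ 2)
      (∑ i, (φ i x - b i) • gradient (φ i) x) x := by
  have h := (HasFDerivAt.fun_sum (u := Finset.univ) fun i _ =>
    (((hφ i).hasGradientAt.hasFDerivAt).sub_const (b i)).pow 2).const_mul (1 / 2 : ℝ)
  rw [hasGradientAt_iff_hasFDerivAt]
  refine h.congr_fderiv ?_
  ext v
  simp [Finset.mul_sum]
  exact Finset.sum_congr rfl fun i _ => by ring

theorem fderiv_gradient_half_sum_sq_sub_apply (hφ : ∀ i, ContDiff ℝ 2 (φ i)) (b : ι → ℝ)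
    (x v : E) :
    fderiv ℝ (gradient fun y => 1 / 2 * ∑ i, (φ i y - b i) ^ 2) x v =
      ∑ i, (φ i x - b i) • fderiv ℝ (gradient (φ i)) x v +
        ∑ i, ⟪gradient (φ i) x, v⟫ • gradient (φ i) x := by
  have hd : ∀ i, Differentiable ℝ (φ i) := fun i => (hφ i).differentiable (by norm_num)
  have hgrad : (gradient fun y => 1 / 2 * ∑ i, (φ i y - b i) ^ 2) =
      fun y => ∑ i, (φ i y - b i) • gradient (φ i) y :=
    funext fun y => (hasGradientAt_half_sum_sq_sub b fun i => hd i y).gradient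
  have h := HasFDerivAt.fun_sum (u := Finset.univ) fun i _ =>
    (((hd i x).hasGradientAt.hasFDerivAt).sub_const (b i)).fun_smul
      ((hφ i).differentiable_gradient_s15 x).hasFDerivAt
  rw [hgrad, h.fderiv]
  simp [Finset.sum_add_distrib]

end GaussNewton

theorem Finset.sum_abs_le_sqrt_card_mul_sum_sq {ι : Type*} (s : Finset ι) (r : ι → ℝ) :
    ∑ i ∈ s, |r i| ≤ √(s.card * ∑ i ∈ s, r i ^ 2) := by
  refine Real.le_sqrt_of_sq_le ?_
  simpa using sq_sum_le_card_mul_sum_sq (s := s) (f := fun i => |r i|)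

/-- Gauss–Newton approximation error for least-squares objectives satisfying the
Polyak–Łojasiewicz condition: `‖∇²f(x) − H(x)‖ ≤ L‖∇f(x)‖√(N/μ) + L√(2N f(x_*))`. -/
theorem stmt15 {n : ℕ} (N : ℕ) (hN : 1 ≤ N) (L μ : ℝ) (hμ : 0 < μ)
    (φ : Fin N → EuclideanSpace ℝ (Fin n) → ℝ) (b : Fin N → ℝ)
    (hφ : ∀ i, ContDiff ℝ 2 (φ i))
    (hHessφ : ∀ i x, ‖fderiv ℝ (gradient (φ i)) x‖ ≤ L)
    (f : EuclideanSpace ℝ (Fin n) → ℝ)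
    (hfdef : ∀ x, f x = 1 / 2 * ∑ i, (φ i x - b i) ^ 2)
    (H : EuclideanSpace ℝ (Fin n) →
      EuclideanSpace ℝ (Fin n) →L[ℝ] EuclideanSpace ℝ (Fin n))
    (hHdef : ∀ x v, H x v = ∑ i, ⟪gradient (φ i) x, v⟫ • gradient (φ i) x)
    (xstar : EuclideanSpace ℝ (Fin n)) (hmin : ∀ y, f xstar ≤ f y)
    (hPL : ∀ x, f x - f xstar ≤ 1 / (2 * μ) * ‖gradient f x‖ ^ 2) :
    ∀ x, ‖fderiv ℝ (gradient f) x - H x‖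
      ≤ L * ‖gradient f x‖ * Real.sqrt (N / μ) + L * Real.sqrt (2 * N * f xstar) := by
  intro x
  have hL : 0 ≤ L := (norm_nonneg _).trans (hHessφ ⟨0, hN⟩ x)
  have hdiff : fderiv ℝ (gradient f) x - H x =
      ∑ i, (φ i x - b i) • fderiv ℝ (gradient (φ i)) x := by
    ext1 v
    rw [sub_apply, funext hfdef,
      fderiv_gradient_half_sum_sq_sub_apply hφ, hHdef, add_sub_cancel_right]
    simp
  have hnorm : ‖fderiv ℝ (gradient f) x - H x‖ ≤ L * ∑ i, |φ i x - b i| := by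
    rw [hdiff, Finset.mul_sum]
    refine norm_sum_le_of_le _ fun i _ => ?_
    rw [norm_smul, Real.norm_eq_abs, mul_comm]
    exact mul_le_mul_of_nonneg_right (hHessφ i x) (abs_nonneg _)
  have hsum : ∑ i, |φ i x - b i| ≤ √(2 * N * f x) := by
    refine (Finset.sum_abs_le_sqrt_card_mul_sum_sq _ _).trans_eq ?_
    rw [hfdef, Finset.card_univ, Fintype.card_fin]
    ring_nf
  have hfstar : 0 ≤ f xstar := by
    rw [hfdef]
    positivity
  have hsqrt : √(2 * N * f x) ≤ ‖gradient f x‖ * √(N / μ) + √(2 * N * f xstar) := by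
    refine Real.sqrt_le_iff.mpr ⟨by positivity, ?_⟩
    have hPLx : 2 * N * f x ≤ ‖gradient f x‖ ^ 2 * (N / μ) + 2 * N * f xstar := by
      have h := mul_le_mul_of_nonneg_left (hPL x) (by positivity : (0 : ℝ) ≤ 2 * N)
      have e : 2 * (N : ℝ) * (1 / (2 * μ) * ‖gradient f x‖ ^ 2) =
          ‖gradient f x‖ ^ 2 * (N / μ) := by
        field_simp
      linarith
    have h1 : √(N / μ) ^ 2 = N / μ := Real.sq_sqrt (by positivity)
    have h2 : √(2 * N * f xstar) ^ 2 = 2 * N * f xstar := Real.sq_sqrt (by positivity)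
    have h3 : 0 ≤ ‖gradient f x‖ * √(N / μ) * √(2 * N * f xstar) := by positivity
    rw [add_sq, mul_pow, h1, h2]
    linarith
  calc ‖fderiv ℝ (gradient f) x - H x‖
      ≤ L * (‖gradient f x‖ * √(N / μ) + √(2 * N * f xstar)) :=
        hnorm.trans (mul_le_mul_of_nonneg_left (hsum.trans hsqrt) hL)
    _ = _ := by ring
end
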